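/- (Corollary for the Neumann problem (P_N).) Let β and δ be real constants with β ≥ max(δ, −1−δ), set α = β − δ, and let k, a, γ, q₀ > 0. Let ξ_N be the unique positive solution of (q₀/(γ·2^β·a^{β+δ+1}))·g(z) = z^{β+δ+1}, where g(z) = 1/M(α/2 + 1/2, 1/2, z²). Set C_{1N} = (2·a·q₀·ξ_N/k)·M(−α/2 + 1/2, 3/2, −ξ_N²)/M(−α/2, 1/2, −ξ_N²) and C_{2N} = −2·a·q₀/k, and define u_N(x,t) = t^{α/2}·[C_{1N}·M(−α/2, 1/2, −η²) + C_{2N}·η·M(−α/2 + 1/2, 3/2, −η²)] with η = x/(2a√t), and s_N(t) = 2ξ_N·a√t. Then: (i) ∂u_N/∂t = a²·∂²u_N/∂x² for all t > 0 and 0 < x < s_N(t); (ii) u_N(s_N(t),t) = 0 for all t > 0; (iii) −k·∂u_N/∂x(s_N(t),t) = γ·s_N(t)^β·ṡ_N(t)^δ·ṡ_N(t) for all t > 0; (iv) s_N(0) = 0; (v) k·∂u_N/∂x(0,t) = −q₀·t^{(α−1)/2} for all t > 0. -/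

import Mathlib

/-- Kummer's confluent hypergeometric function
`M(a,b,z) = ∑ (a)_n / (b)_n · zⁿ/n!`, with `(a)_n` the rising factorial. -/
noncomputable def kummerM (a b z : ℝ) : ℝ :=
  ∑' n : ℕ, ((ascPochhammer ℝ n).eval a / (ascPochhammer ℝ n).eval b) * z ^ n / (n.factorial : ℝ)

/-- The coefficients of a power series that converges absolutely on the whole real line. -/
def EntireCoeff (c : ℕ → ℝ) : Prop := ∀ r : ℝ, 0 ≤ r → Summable fun n => |c n| * r ^ n

/-- The coefficients of the termwise derivative of the power series with coefficients `c`. -/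
def derivCoeff (c : ℕ → ℝ) (n : ℕ) : ℝ := (n + 1) * c (n + 1)

theorem EntireCoeff.summable {c : ℕ → ℝ} (hc : EntireCoeff c) (z : ℝ) :
    Summable fun n => c n * z ^ n := by
  refine Summable.of_norm ?_
  simpa [abs_mul] using hc |z| (abs_nonneg z)

theorem EntireCoeff.summable_nat_mul {c : ℕ → ℝ} (hc : EntireCoeff c) {r : ℝ} (hr : 1 ≤ r) :
    Summable fun n : ℕ => |c n| * (n * r ^ (n - 1)) := by
  refine Summable.of_nonneg_of_le (fun n => by positivity) (fun n => ?_)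
    (hc (2 * r) (by positivity))
  rw [mul_pow]
  have h1 : (n : ℝ) ≤ 2 ^ n := by exact_mod_cast Nat.lt_two_pow_self.le
  have h2 : r ^ (n - 1) ≤ r ^ n := pow_le_pow_right₀ hr (Nat.sub_le _ _)
  gcongr

theorem EntireCoeff.derivCoeff {c : ℕ → ℝ} (hc : EntireCoeff c) :
    EntireCoeff (derivCoeff c) := by
  intro r hr
  have h := (summable_nat_add_iff 1).2 (hc.summable_nat_mul (r := r + 1) (by linarith))
  refine Summable.of_nonneg_of_le (fun n => by positivity) (fun n => ?_) h
  have h1 : r ^ n ≤ (r + 1) ^ n := by gcongr; linarith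
  have h2 : |(n : ℝ) + 1| = n + 1 := abs_of_nonneg (by positivity)
  simp only [_root_.derivCoeff, abs_mul, h2, Nat.add_sub_cancel, Nat.cast_add, Nat.cast_one]
  calc (n + 1) * |c (n + 1)| * r ^ n ≤ (n + 1) * |c (n + 1)| * (r + 1) ^ n := by gcongr
    _ = _ := by ring

theorem EntireCoeff.hasDerivAt {c : ℕ → ℝ} (hc : EntireCoeff c) (z : ℝ) :
    HasDerivAt (fun y => ∑' n, c n * y ^ n) (∑' n, _root_.derivCoeff c n * z ^ n) z := by
  have key : HasDerivAt (fun y => ∑' n, c n * y ^ n)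
      (∑' n : ℕ, c n * (n * z ^ (n - 1))) z := by
    refine hasDerivAt_tsum_of_isPreconnected (t := Metric.ball 0 (|z| + 1)) (y₀ := 0)
      (hc.summable_nat_mul (r := |z| + 1) (by linarith [abs_nonneg z]))
      Metric.isOpen_ball (convex_ball _ _).isPreconnected
      (fun n y _ => (hasDerivAt_pow n y).const_mul (c n)) (fun n y hy => ?_)
      (by simp; positivity) (hc.summable 0) (by simp)
    rw [Metric.mem_ball, dist_zero_right, Real.norm_eq_abs] at hy
    simp only [norm_mul, norm_pow, Real.norm_eq_abs, Nat.abs_cast]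
    gcongr
  convert key using 1
  have hs : Summable fun n : ℕ => c n * (n * z ^ (n - 1)) := by
    refine Summable.of_norm_bounded (hc.summable_nat_mul (r := |z| + 1)
      (by linarith [abs_nonneg z])) (fun n => ?_)
    simp only [norm_mul, norm_pow, Real.norm_eq_abs, Nat.abs_cast]
    gcongr
    linarith
  rw [hs.tsum_eq_zero_add]
  simp only [CharP.cast_eq_zero, zero_mul, mul_zero, zero_add, _root_.derivCoeff]
  exact tsum_congr fun n => by push_cast; ring

/-- The Taylor coefficients of `kummerM a b` at the origin. -/
noncomputable def kummerCoeff (a b : ℝ) (n : ℕ) : ℝ :=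
  (ascPochhammer ℝ n).eval a / (ascPochhammer ℝ n).eval b / n.factorial

theorem kummerM_eq_tsum (a b : ℝ) : kummerM a b = fun z => ∑' n, kummerCoeff a b n * z ^ n := by
  funext z
  exact tsum_congr fun n => by rw [kummerCoeff]; ring

theorem kummerCoeff_succ {a b : ℝ} (hb : 0 < b) (n : ℕ) :
    (n + 1) * (b + n) * kummerCoeff a b (n + 1) = (a + n) * kummerCoeff a b n := by
  have h1 : (ascPochhammer ℝ n).eval b ≠ 0 := (ascPochhammer_pos n b hb).ne'
  have h2 : b + n ≠ 0 := by positivity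
  simp only [kummerCoeff, ascPochhammer_succ_eval, Nat.factorial_succ]
  push_cast
  field_simp

theorem entireCoeff_kummerCoeff {a b : ℝ} (hb : 0 < b) : EntireCoeff (kummerCoeff a b) := by
  intro r hr
  refine summable_of_ratio_norm_eventually_le (r := 1 / 2) (by norm_num) ?_
  filter_upwards [Filter.eventually_ge_atTop ⌈2 * (1 + |a| / b) * r⌉₊] with n hn
  have hn' : 2 * (1 + |a| / b) * r ≤ n := Nat.ceil_le.1 hn
  have hbn : 0 < b + n := by positivity
  have habs := congrArg abs (kummerCoeff_succ (a := a) hb n)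
  rw [abs_mul, abs_mul, abs_mul, abs_of_pos hbn, abs_of_pos (by positivity : (0 : ℝ) < n + 1)]
    at habs
  have han : |a + n| ≤ (1 + |a| / b) * (b + n) := by
    have h1 : |a + n| ≤ |a| + n := (abs_add_le _ _).trans (by simp)
    have h2 : (1 + |a| / b) * (b + n) = |a| + n + (b + |a| / b * n) := by field_simp; ring
    have h3 : 0 ≤ b + |a| / b * n := by positivity
    linarith
  simp only [norm_mul, norm_pow, Real.norm_eq_abs, abs_abs, abs_of_nonneg hr, pow_succ]
  have hpos : 0 < (n + 1) * (b + n) := by positivity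
  refine le_of_mul_le_mul_left ?_ hpos
  have e : (n + 1) * (b + n) * (|kummerCoeff a b (n + 1)| * (r ^ n * r)) =
      |a + n| * r * (|kummerCoeff a b n| * r ^ n) := by linear_combination (r ^ n * r) * habs
  rw [e]
  have hcoef : |a + n| * r ≤ (n + 1) * (b + n) * (1 / 2) := by
    calc |a + n| * r ≤ (1 + |a| / b) * (b + n) * r := by gcongr
      _ = (b + n) * (1 / 2) * (2 * (1 + |a| / b) * r) := by ring
      _ ≤ (b + n) * (1 / 2) * (n + 1) := by gcongr; linarith
      _ = _ := by ring
  calc _ ≤ (n + 1) * (b + n) * (1 / 2) * (|kummerCoeff a b n| * r ^ n) := by gcongr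
    _ = _ := by ring

theorem kummerM_zero (a b : ℝ) : kummerM a b 0 = 1 := by
  rw [kummerM, tsum_eq_single 0 (fun n hn => by simp [hn])]
  simp

theorem kummerM_pos {a b z : ℝ} (ha : 0 < a) (hb : 0 < b) (hz : 0 ≤ z) : 0 < kummerM a b z := by
  rw [kummerM_eq_tsum]
  have hc : ∀ n, 0 < kummerCoeff a b n := fun n => by
    have h1 := ascPochhammer_pos n a ha
    have h2 := ascPochhammer_pos n b hb
    unfold kummerCoeff
    positivity
  refine ((entireCoeff_kummerCoeff hb).summable z).tsum_pos
    (fun n => mul_nonneg (hc n).le (pow_nonneg hz n)) 0 ?_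
  simpa using hc 0

/-- Kummer's equation `z M'' + (b - z) M' = a M`, with the derivatives of `M` named. -/
theorem exists_kummerM_deriv (a : ℝ) {b : ℝ} (hb : 0 < b) :
    ∃ M₁ M₂ : ℝ → ℝ, (∀ z, HasDerivAt (kummerM a b) (M₁ z) z) ∧
      (∀ z, HasDerivAt M₁ (M₂ z) z) ∧
      ∀ z, z * M₂ z + (b - z) * M₁ z = a * kummerM a b z := by
  have h0 : EntireCoeff (kummerCoeff a b) := entireCoeff_kummerCoeff hb
  have h1 := h0.derivCoeff
  have h2 := h1.derivCoeff
  rw [kummerM_eq_tsum]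
  refine ⟨_, _, h0.hasDerivAt, h1.hasDerivAt, fun z => ?_⟩
  have s0 := (h0.summable z).hasSum
  have s1 := (h1.summable z).hasSum
  have s2 := (h2.summable z).hasSum
  have t1 : HasSum (fun n : ℕ => n * kummerCoeff a b n * z ^ n)
      (z * ∑' n, derivCoeff (kummerCoeff a b) n * z ^ n) := by
    refine (hasSum_nat_add_iff' 1).1 ?_
    simp only [Finset.sum_range_one, CharP.cast_eq_zero, zero_mul, sub_zero]
    refine (s1.mul_left z).congr_fun fun n => ?_
    simp only [derivCoeff]
    push_cast
    ring
  have t2 : HasSum (fun n : ℕ => n * derivCoeff (kummerCoeff a b) n * z ^ n)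
      (z * ∑' n, derivCoeff (derivCoeff (kummerCoeff a b)) n * z ^ n) := by
    refine (hasSum_nat_add_iff' 1).1 ?_
    simp only [Finset.sum_range_one, CharP.cast_eq_zero, zero_mul, sub_zero]
    refine (s2.mul_left z).congr_fun fun n => ?_
    simp only [derivCoeff]
    push_cast
    ring
  have t := ((t2.add (s1.mul_left b)).sub t1).sub (s0.mul_left a)
  have hz := t.unique (hasSum_zero.congr_fun fun n => ?_)
  · linear_combination hz
  · simp only [derivCoeff]
    linear_combination z ^ n * kummerCoeff_succ (a := a) hb n

/-- `f` has derivative `f₁` and solves the similarity form `f'' + 2 η f' = 2 α f` of the heat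
equation. -/
structure IsSimilaritySolution (α : ℝ) (f f₁ : ℝ → ℝ) : Prop where
  hasDerivAt : ∀ x, HasDerivAt f (f₁ x) x
  hasDerivAt' : ∀ x, HasDerivAt f₁ (2 * α * f x - 2 * x * f₁ x) x

theorem IsSimilaritySolution.linearCombination {α : ℝ} {f f₁ g g₁ : ℝ → ℝ}
    (hf : IsSimilaritySolution α f f₁) (hg : IsSimilaritySolution α g g₁) (A B : ℝ) :
    IsSimilaritySolution α (fun x => A * f x + B * g x) (fun x => A * f₁ x + B * g₁ x) where
  hasDerivAt x := ((hf.hasDerivAt x).const_mul A).add ((hg.hasDerivAt x).const_mul B)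
  hasDerivAt' x := by
    refine (((hf.hasDerivAt' x).const_mul A).add ((hg.hasDerivAt' x).const_mul B)).congr_deriv ?_
    ring

theorem hasDerivAt_exp_sq (x : ℝ) :
    HasDerivAt (fun y => Real.exp (y ^ 2)) (2 * x * Real.exp (x ^ 2)) x := by
  refine ((hasDerivAt_pow 2 x).exp).congr_deriv ?_
  simp
  ring

theorem hasDerivAt_exp_neg_sq (x : ℝ) :
    HasDerivAt (fun y => Real.exp (-y ^ 2)) (-(2 * x) * Real.exp (-x ^ 2)) x := by
  refine ((hasDerivAt_pow 2 x).neg.exp).congr_deriv ?_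
  simp
  ring

theorem IsSimilaritySolution.wronskian {α : ℝ} {f f₁ g g₁ : ℝ → ℝ}
    (hf : IsSimilaritySolution α f f₁) (hg : IsSimilaritySolution α g g₁) (x : ℝ) :
    f x * g₁ x - f₁ x * g x = (f 0 * g₁ 0 - f₁ 0 * g 0) * Real.exp (-x ^ 2) := by
  have hd : ∀ y, HasDerivAt (fun y => (f y * g₁ y - f₁ y * g y) * Real.exp (y ^ 2)) 0 y := by
    intro y
    refine ((((hf.hasDerivAt y).mul (hg.hasDerivAt' y)).sub
      ((hf.hasDerivAt' y).mul (hg.hasDerivAt y))).mul (hasDerivAt_exp_sq y)).congr_deriv ?_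
    simp
    ring
  have hconst := is_const_of_deriv_eq_zero (fun y => (hd y).differentiableAt)
    (fun y => (hd y).deriv) x 0
  have he : Real.exp (x ^ 2) * Real.exp (-x ^ 2) = 1 := by rw [← Real.exp_add]; simp
  simp only [ne_eq, OfNat.ofNat_ne_zero, not_false_eq_true, zero_pow, Real.exp_zero, mul_one]
    at hconst
  rw [← hconst, mul_assoc, he, mul_one]

theorem exists_isSimilaritySolution_even (α : ℝ) : ∃ f₁ : ℝ → ℝ, f₁ 0 = 0 ∧
    IsSimilaritySolution α (fun x => kummerM (-α / 2) (1 / 2) (-x ^ 2)) f₁ := by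
  obtain ⟨M₁, M₂, h1, h2, hode⟩ := exists_kummerM_deriv (-α / 2) (b := 1 / 2) (by norm_num)
  have hsq : ∀ x : ℝ, HasDerivAt (fun y : ℝ => -y ^ 2) (-(2 * x)) x := fun x => by
    simpa using (hasDerivAt_pow 2 x).fun_neg
  refine ⟨fun x => M₁ (-x ^ 2) * -(2 * x), by simp, fun x => (h1 _).comp x (hsq x), fun x => ?_⟩
  refine (((h2 _).comp x (hsq x)).mul ((hasDerivAt_id x).const_mul 2).neg).congr_deriv ?_
  simp only [Function.comp, id, Pi.neg_apply]
  linear_combination (-4) * hode (-x ^ 2)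

theorem exists_isSimilaritySolution_odd (α : ℝ) : ∃ f₁ : ℝ → ℝ, f₁ 0 = 1 ∧
    IsSimilaritySolution α (fun x => x * kummerM (-α / 2 + 1 / 2) (3 / 2) (-x ^ 2)) f₁ := by
  obtain ⟨M₁, M₂, h1, h2, hode⟩ :=
    exists_kummerM_deriv (-α / 2 + 1 / 2) (b := 3 / 2) (by norm_num)
  have hsq : ∀ x : ℝ, HasDerivAt (fun y : ℝ => -y ^ 2) (-(2 * x)) x := fun x => by
    simpa using (hasDerivAt_pow 2 x).fun_neg
  refine ⟨fun x => 1 * kummerM (-α / 2 + 1 / 2) (3 / 2) (-x ^ 2) + x * (M₁ (-x ^ 2) * -(2 * x)),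
    by simp [kummerM_zero], fun x => (hasDerivAt_id x).mul ((h1 _).comp x (hsq x)), fun x => ?_⟩
  refine ((((h1 _).comp x (hsq x)).const_mul 1).add ((hasDerivAt_id x).mul
    (((h2 _).comp x (hsq x)).mul ((hasDerivAt_id x).const_mul 2).neg))).congr_deriv ?_
  simp only [Function.comp, id, Pi.mul_apply, Pi.neg_apply]
  linear_combination (-4 * x) * hode (-x ^ 2)

theorem exists_isSimilaritySolution_exp (α : ℝ) : ∃ f₁ : ℝ → ℝ, f₁ 0 = 0 ∧
    IsSimilaritySolution α
      (fun x => Real.exp (-x ^ 2) * kummerM (α / 2 + 1 / 2) (1 / 2) (x ^ 2)) f₁ := by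
  obtain ⟨M₁, M₂, h1, h2, hode⟩ :=
    exists_kummerM_deriv (α / 2 + 1 / 2) (b := 1 / 2) (by norm_num)
  have hsq : ∀ x : ℝ, HasDerivAt (fun y : ℝ => y ^ 2) (2 * x) x := fun x => by
    simpa using hasDerivAt_pow 2 x
  have hM := fun x : ℝ => (h1 _).comp x (hsq x)
  have hlin := fun x : ℝ => (hasDerivAt_id x).const_mul 2
  refine ⟨fun x => -(2 * x) * Real.exp (-x ^ 2) * kummerM (α / 2 + 1 / 2) (1 / 2) (x ^ 2) +
    Real.exp (-x ^ 2) * (M₁ (x ^ 2) * (2 * x)), by simp,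
    fun x => (hasDerivAt_exp_neg_sq x).mul (hM x), fun x => ?_⟩
  refine ((((hlin x).neg.mul (hasDerivAt_exp_neg_sq x)).mul (hM x)).add
    ((hasDerivAt_exp_neg_sq x).mul (((h2 _).comp x (hsq x)).mul (hlin x)))).congr_deriv ?_
  simp only [Function.comp, id, Pi.mul_apply, Pi.neg_apply]
  linear_combination (4 * Real.exp (-x ^ 2)) * hode (x ^ 2)

/-- Kummer's transformation `M(-α/2, 1/2, -x²) = exp(-x²) M(α/2 + 1/2, 1/2, x²)`. -/
theorem kummerM_neg_sq {α : ℝ} (hα : 0 ≤ α) (x : ℝ) :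
    kummerM (-α / 2) (1 / 2) (-x ^ 2) =
      Real.exp (-x ^ 2) * kummerM (α / 2 + 1 / 2) (1 / 2) (x ^ 2) := by
  obtain ⟨f₁, hf0, hf⟩ := exists_isSimilaritySolution_even α
  obtain ⟨h₁, hh0, hh⟩ := exists_isSimilaritySolution_exp α
  have hW := hf.wronskian hh
  simp only [hf0, hh0, mul_zero, zero_mul, sub_zero] at hW
  have hpos : ∀ y : ℝ, Real.exp (-y ^ 2) * kummerM (α / 2 + 1 / 2) (1 / 2) (y ^ 2) ≠ 0 := fun y =>
    (mul_pos (Real.exp_pos _) (kummerM_pos (by positivity) (by norm_num) (sq_nonneg y))).ne'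
  have hd : ∀ y, HasDerivAt (fun y => kummerM (-α / 2) (1 / 2) (-y ^ 2) /
      (Real.exp (-y ^ 2) * kummerM (α / 2 + 1 / 2) (1 / 2) (y ^ 2))) 0 y := fun y => by
    refine ((hf.hasDerivAt y).div (hh.hasDerivAt y) (hpos y)).congr_deriv ?_
    rw [div_eq_zero_iff]
    left
    linear_combination - hW y
  have hconst := is_const_of_deriv_eq_zero (fun y => (hd y).differentiableAt)
    (fun y => (hd y).deriv) x 0
  simp only [ne_eq, OfNat.ofNat_ne_zero, not_false_eq_true, zero_pow, neg_zero, Real.exp_zero,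
    kummerM_zero, mul_one, div_one] at hconst
  exact (div_eq_one_iff_eq (hpos x)).1 hconst

section SelfSimilar

variable {α a : ℝ} {φ φ₁ : ℝ → ℝ}

theorem IsSimilaritySolution.hasDerivAt_space (hφ : IsSimilaritySolution α φ φ₁) (t x : ℝ) :
    HasDerivAt (fun y => t ^ (α / 2) * φ (y / (2 * a * Real.sqrt t)))
      (t ^ (α / 2) * (φ₁ (x / (2 * a * Real.sqrt t)) / (2 * a * Real.sqrt t))) x := by
  have h : HasDerivAt (fun y => y / (2 * a * Real.sqrt t)) (1 / (2 * a * Real.sqrt t)) x :=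
    (hasDerivAt_id x).div_const _
  refine (((hφ.hasDerivAt _).comp x h).const_mul _).congr_deriv ?_
  ring

/-- Self-similar functions built from solutions of the similarity equation solve the heat
equation. -/
theorem IsSimilaritySolution.heat (hφ : IsSimilaritySolution α φ φ₁) (ha : 0 < a) {t : ℝ}
    (ht : 0 < t) (x : ℝ) :
    deriv (fun τ => τ ^ (α / 2) * φ (x / (2 * a * Real.sqrt τ))) t =
      a ^ 2 * deriv (deriv fun y => t ^ (α / 2) * φ (y / (2 * a * Real.sqrt t))) x := by
  have hst : 0 < Real.sqrt t := Real.sqrt_pos.2 ht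
  have hsq : Real.sqrt t ^ 2 = t := Real.sq_sqrt ht.le
  have h1 : deriv (fun y => t ^ (α / 2) * φ (y / (2 * a * Real.sqrt t))) =
      fun y => t ^ (α / 2) * (φ₁ (y / (2 * a * Real.sqrt t)) / (2 * a * Real.sqrt t)) :=
    funext fun y => (hφ.hasDerivAt_space t y).deriv
  have hη : HasDerivAt (fun y => y / (2 * a * Real.sqrt t)) (1 / (2 * a * Real.sqrt t)) x :=
    (hasDerivAt_id x).div_const _
  have h2 := ((((hφ.hasDerivAt' _).comp x hη).div_const (2 * a * Real.sqrt t)).const_mul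
    (t ^ (α / 2))).deriv
  have hητ : HasDerivAt (fun τ => x / (2 * a * Real.sqrt τ))
      (-(x / (2 * a * Real.sqrt t)) / (2 * t)) t := by
    refine ((hasDerivAt_const t x).div ((Real.hasDerivAt_sqrt ht.ne').const_mul (2 * a))
      (by positivity)).congr_deriv ?_
    conv_rhs => rw [← hsq]
    rw [Real.sqrt_sq hst.le]
    field_simp
    ring
  have h3 := ((Real.hasDerivAt_rpow_const (p := α / 2) (Or.inl ht.ne')).mul
    ((hφ.hasDerivAt _).comp t hητ)).deriv
  rw [h1]
  refine h3.trans ?_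
  refine Eq.trans ?_ (congrArg (a ^ 2 * ·) h2.symm)
  rw [Real.rpow_sub_one ht.ne']
  simp only [Function.comp]
  generalize φ (x / (2 * a * Real.sqrt t)) = p
  generalize φ₁ (x / (2 * a * Real.sqrt t)) = p₁
  generalize t ^ (α / 2) = T
  conv_lhs => rw [← hsq]
  rw [Real.sqrt_sq hst.le]
  field_simp
  ring

end SelfSimilar

/-- Corollary (Neumann problem (P_N)): with `β ≥ max(δ,−1−δ)`, `α = β − δ`, `ξ_N` the
positive root of `(q₀/(γ·2^β·a^{β+δ+1}))·g(z) = z^{β+δ+1}`, `g(z) = 1/M(α/2+1/2,1/2,z²)`,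
the similarity pair `(u_N, s_N)` solves the Stefan-like problem with the Neumann
heat-flux condition `k·∂u/∂x(0,t) = −q₀·t^{(α−1)/2}` at the fixed face. -/
theorem stmt9 (β δ k a γ q₀ : ℝ) (hβ : β ≥ max δ (-1 - δ))
    (hk : 0 < k) (ha : 0 < a) (hγ : 0 < γ) (hq : 0 < q₀)
    (α : ℝ) (hα : α = β - δ)
    (ξN : ℝ) (hξpos : 0 < ξN)
    (hξ : (q₀ / (γ * (2:ℝ) ^ β * a ^ (β + δ + 1))) *
      (1 / kummerM (α/2 + 1/2) (1/2) (ξN^2)) = ξN ^ (β + δ + 1))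
    (C₁N C₂N : ℝ)
    (hC₁ : C₁N = (2 * a * q₀ * ξN / k) *
      (kummerM (-α/2 + 1/2) (3/2) (-ξN^2) / kummerM (-α/2) (1/2) (-ξN^2)))
    (hC₂ : C₂N = -2 * a * q₀ / k)
    (uN : ℝ → ℝ → ℝ)
    (hu : uN = fun x t => t ^ (α/2) *
      (C₁N * kummerM (-α/2) (1/2) (-(x / (2 * a * Real.sqrt t))^2) +
       C₂N * (x / (2 * a * Real.sqrt t)) *
         kummerM (-α/2 + 1/2) (3/2) (-(x / (2 * a * Real.sqrt t))^2)))
    (sN : ℝ → ℝ) (hs : sN = fun t => 2 * ξN * a * Real.sqrt t) :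
    (∀ t x : ℝ, 0 < t → 0 < x → x < sN t →
      deriv (fun τ => uN x τ) t = a^2 * deriv (deriv (fun y => uN y t)) x) ∧
    (∀ t : ℝ, 0 < t → uN (sN t) t = 0) ∧
    (∀ t : ℝ, 0 < t → -k * deriv (fun y => uN y t) (sN t) =
      γ * (sN t) ^ β * (deriv sN t) ^ δ * deriv sN t) ∧
    sN 0 = 0 ∧
    (∀ t : ℝ, 0 < t → k * deriv (fun y => uN y t) 0 = -q₀ * t ^ ((α - 1)/2)) := by
  have hα₀ : 0 ≤ α := by
    have := (le_max_left _ _).trans hβ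
    linarith
  obtain ⟨f₁, hf0, hf⟩ := exists_isSimilaritySolution_even α
  obtain ⟨g₁, hg0, hg⟩ := exists_isSimilaritySolution_odd α
  have hW := hf.wronskian hg ξN
  have hK := kummerM_neg_sq hα₀ ξN
  have hM : 0 < kummerM (α / 2 + 1 / 2) (1 / 2) (ξN ^ 2) :=
    kummerM_pos (by positivity) (by norm_num) (sq_nonneg _)
  have hF : 0 < kummerM (-α / 2) (1 / 2) (-ξN ^ 2) := by rw [hK]; positivity
  have hφ := hf.linearCombination hg C₁N C₂N
  have hu' : uN = fun x t => t ^ (α / 2) *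
      (fun η => C₁N * kummerM (-α / 2) (1 / 2) (-η ^ 2) +
        C₂N * (η * kummerM (-α / 2 + 1 / 2) (3 / 2) (-η ^ 2))) (x / (2 * a * Real.sqrt t)) := by
    rw [hu]
    funext x t
    ring
  have hη : ∀ t, 0 < t → sN t / (2 * a * Real.sqrt t) = ξN := fun t ht => by
    have := Real.sqrt_pos.2 ht
    rw [hs]
    field_simp
  have hux : ∀ x t, deriv (fun y => uN y t) x = t ^ (α / 2) *
      ((C₁N * f₁ (x / (2 * a * Real.sqrt t)) + C₂N * g₁ (x / (2 * a * Real.sqrt t))) /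
        (2 * a * Real.sqrt t)) := fun x t => by
    rw [hu']
    exact (hφ.hasDerivAt_space t x).deriv
  have hhalf : ∀ t : ℝ, 0 < t → t ^ ((α - 1) / 2) = t ^ (α / 2) / Real.sqrt t := fun t ht => by
    rw [sub_div, Real.rpow_sub ht, Real.sqrt_eq_rpow]
  refine ⟨fun t x ht _ _ => ?_, fun t ht => ?_, fun t ht => ?_, by simp [hs], fun t ht => ?_⟩
  · rw [hu']
    exact hφ.heat ha ht x
  · simp only [hu', hη t ht]
    rw [hC₁, hC₂]
    generalize kummerM (-α / 2) (1 / 2) (-ξN ^ 2) = F at hF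
    field_simp
    ring
  · have hst := Real.sqrt_pos.2 ht
    have hflux : C₁N * f₁ ξN + C₂N * g₁ ξN =
        -2 * a * q₀ / k / kummerM (α / 2 + 1 / 2) (1 / 2) (ξN ^ 2) := by
      simp only [hf0, hg0, zero_mul, sub_zero, mul_one, ne_eq, OfNat.ofNat_ne_zero,
        not_false_eq_true, zero_pow, neg_zero, kummerM_zero, one_mul] at hW
      have hC : C₁N * f₁ ξN + C₂N * g₁ ξN =
          C₂N * Real.exp (-ξN ^ 2) / kummerM (-α / 2) (1 / 2) (-ξN ^ 2) := by
        rw [← hW, hC₁, hC₂]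
        generalize kummerM (-α / 2) (1 / 2) (-ξN ^ 2) = F at hF
        field_simp
        ring
      rw [hC, hK, hC₂]
      have := Real.exp_pos (-ξN ^ 2)
      field_simp
    have hds : deriv sN t = ξN * a / Real.sqrt t := by
      rw [hs, ((Real.hasDerivAt_sqrt ht.ne').const_mul (2 * ξN * a)).deriv]
      field_simp
    have hβδ : Real.sqrt t ^ β / Real.sqrt t ^ (δ + 1) = t ^ ((α - 1) / 2) := by
      rw [← Real.rpow_sub hst, Real.sqrt_eq_rpow, ← Real.rpow_mul ht.le]
      congr 1
      rw [hα]
      ring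
    have hpow : sN t ^ β * deriv sN t ^ δ * deriv sN t =
        2 ^ β * a ^ (β + δ + 1) * ξN ^ (β + δ + 1) * t ^ ((α - 1) / 2) := by
      rw [mul_assoc, hds, ← Real.rpow_add_one (by positivity), ← hβδ, hs,
        Real.div_rpow (by positivity) hst.le, Real.mul_rpow (by positivity) hst.le,
        Real.mul_rpow (by positivity) ha.le, Real.mul_rpow (by norm_num) hξpos.le,
        Real.mul_rpow hξpos.le ha.le, add_assoc, Real.rpow_add ha β,
        Real.rpow_add hξpos β]
      ring
    have hpow' := congrArg (γ * ·) hpow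
    simp only [← mul_assoc] at hpow'
    rw [hux, hη t ht, hflux, hpow', ← hξ, hhalf t ht]
    have := Real.rpow_pos_of_pos ha (β + δ + 1)
    have := Real.rpow_pos_of_pos (two_pos (α := ℝ)) β
    field_simp
  · have hst := Real.sqrt_pos.2 ht
    rw [hux, hhalf t ht, zero_div, hf0, hg0, hC₂]
    field_simp
    ring
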